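/- arXiv:2401.11325 — 4 statements merged into one kernel-verified Lean document; each statement's English description precedes it below -/
import Mathlib

section
/- Let l and K be positive integers and let O : {1,…,l} × {1,…,K} × {1,…,K} → {0,1} satisfy constraint (C1) (for every n, ∑_{i=1}^{K} ∑_{j=1}^{K} O(n,i,j) = 1), the initial-state constraint (C2) (∑_{j=1}^{K} O(1,1,j) = 1), and the continuity constraint (C3) (for every n ∈ {1,…,l−1} and every j, ∑_{i=1}^{K} O(n,i,j) = ∑_{j'=1}^{K} O(n+1,j,j')). Then there exists a unique sequence u : {1,…,l+1} → {1,…,K} such that u(1) = 1 and O(n, u(n), u(n+1)) = 1 for every n ∈ {1,…,l}. -/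
/-- A `{0, 1}`-valued function whose sum over `s` is `1` is the indicator of one point of `s`. -/
theorem Finset.exists_eq_one_of_sum_eq_one {α R : Type*} [Ring R] [PartialOrder R]
    [IsOrderedRing R] [Nontrivial R] {s : Finset α} {f : α → R}
    (hf : ∀ a ∈ s, f a = 0 ∨ f a = 1) (hs : ∑ a ∈ s, f a = 1) :
    ∃ a ∈ s, f a = 1 ∧ ∀ b ∈ s, f b ≠ 0 → b = a := by
  classical
  obtain ⟨a, ha, hfa⟩ := Finset.exists_ne_zero_of_sum_ne_zero (hs.trans_ne one_ne_zero)
  have hfa1 := (hf a ha).resolve_left hfa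
  have hrest : ∑ b ∈ s.erase a, f b = 0 := by
    rwa [← Finset.add_sum_erase s f ha, hfa1, add_eq_left] at hs
  rw [Finset.sum_eq_zero_iff_of_nonneg fun b hb ↦ ?_] at hrest
  · refine ⟨a, ha, hfa1, fun b hb hfb ↦ ?_⟩
    by_contra hba
    exact hfb (hrest b (Finset.mem_erase.2 ⟨hba, hb⟩))
  · rcases hf b (Finset.mem_of_mem_erase hb) with h | h <;> simp [h]


/-- Under constraints (C1) (exactly one pair per step), (C2) (initial state) and
(C3) (continuity), there exists a unique sequence `u : {1,…,l+1} → {1,…,K}` with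
`u 1 = 1` and `O n (u n) (u (n+1)) = 1` for every `n ∈ {1,…,l}`. -/
theorem unique_run (l K : ℕ) (hl : 0 < l) (hK : 0 < K)
    (O : ℕ → ℕ → ℕ → ℝ)
    (hbin : ∀ n ∈ Finset.Icc 1 l, ∀ i ∈ Finset.Icc 1 K, ∀ j ∈ Finset.Icc 1 K,
      O n i j = 0 ∨ O n i j = 1)
    (hC1 : ∀ n ∈ Finset.Icc 1 l,
      ∑ i ∈ Finset.Icc 1 K, ∑ j ∈ Finset.Icc 1 K, O n i j = 1)
    (hC2 : ∑ j ∈ Finset.Icc 1 K, O 1 1 j = 1)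
    (hC3 : ∀ n ∈ Finset.Icc 1 (l - 1), ∀ j ∈ Finset.Icc 1 K,
      ∑ i ∈ Finset.Icc 1 K, O n i j = ∑ j' ∈ Finset.Icc 1 K, O (n + 1) j j') :
    ∃ u : ℕ → ℕ,
      ((∀ n ∈ Finset.Icc 1 (l + 1), u n ∈ Finset.Icc 1 K) ∧ u 1 = 1 ∧
        ∀ n ∈ Finset.Icc 1 l, O n (u n) (u (n + 1)) = 1) ∧
      ∀ v : ℕ → ℕ,
        ((∀ n ∈ Finset.Icc 1 (l + 1), v n ∈ Finset.Icc 1 K) ∧ v 1 = 1 ∧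
          ∀ n ∈ Finset.Icc 1 l, O n (v n) (v (n + 1)) = 1) →
        ∀ n ∈ Finset.Icc 1 (l + 1), v n = u n := by
  have hpair : ∀ n ∈ Finset.Icc 1 l, ∃ p ∈ Finset.Icc 1 K, ∃ q ∈ Finset.Icc 1 K,
      O n p q = 1 ∧ ∀ i ∈ Finset.Icc 1 K, ∀ j ∈ Finset.Icc 1 K, O n i j ≠ 0 → i = p ∧ j = q := by
    intro n hn
    obtain ⟨⟨p, q⟩, hpq, hO, huniq⟩ := Finset.exists_eq_one_of_sum_eq_one
      (s := Finset.Icc 1 K ×ˢ Finset.Icc 1 K) (f := fun x ↦ O n x.1 x.2)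
      (fun x hx ↦ hbin n hn _ (Finset.mem_product.1 hx).1 _ (Finset.mem_product.1 hx).2)
      (by rw [Finset.sum_product]; exact hC1 n hn)
    obtain ⟨hp, hq⟩ := Finset.mem_product.1 hpq
    exact ⟨p, hp, q, hq, hO, fun i hi j hj h ↦
      Prod.mk.inj (huniq (i, j) (Finset.mk_mem_product hi hj) h)⟩
  choose! p hp q hq hO huniq using hpair
  have h1l : 1 ∈ Finset.Icc 1 l := Finset.mem_Icc.2 ⟨le_rfl, hl⟩
  have h1K : 1 ∈ Finset.Icc 1 K := Finset.mem_Icc.2 ⟨le_rfl, hK⟩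
  have hinit : p 1 = 1 := by
    obtain ⟨j, hj, h⟩ := Finset.exists_ne_zero_of_sum_ne_zero (hC2.trans_ne one_ne_zero)
    exact (huniq 1 h1l 1 h1K j hj h).1.symm
  have hstep : ∀ n, 1 ≤ n → n + 1 ≤ l → p (n + 1) = q n := by
    intro n hn1 hnl
    have hn : n ∈ Finset.Icc 1 l := Finset.mem_Icc.2 ⟨hn1, by lia⟩
    have hn' : n + 1 ∈ Finset.Icc 1 l := Finset.mem_Icc.2 ⟨by lia, hnl⟩
    have hpos : 0 < ∑ i ∈ Finset.Icc 1 K, O n i (q n) := by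
      refine Finset.sum_pos' (fun i hi ↦ ?_) ⟨p n, hp n hn, by simp [hO n hn]⟩
      rcases hbin n hn i hi (q n) (hq n hn) with h | h <;> simp [h]
    rw [hC3 n (Finset.mem_Icc.2 ⟨hn1, by lia⟩) _ (hq n hn)] at hpos
    obtain ⟨j, hj, h⟩ := Finset.exists_ne_zero_of_sum_ne_zero hpos.ne'
    exact (huniq (n + 1) hn' (q n) (hq n hn) j hj h).1.symm
  refine ⟨fun n ↦ if n = 1 then 1 else q (n - 1), ⟨fun n hn ↦ ?_, by simp, fun n hn ↦ ?_⟩,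
    fun v ⟨hv, hv1, hvO⟩ n hn ↦ ?_⟩
  · rw [Finset.mem_Icc] at hn
    dsimp only
    split_ifs with h
    · exact h1K
    · exact hq _ (Finset.mem_Icc.2 (by lia))
  · obtain ⟨hn1, hnl⟩ := Finset.mem_Icc.1 hn
    have hfst : (if n = 1 then 1 else q (n - 1)) = p n := by
      split_ifs with h
      · rw [h, hinit]
      · rw [← hstep (n - 1) (by lia) (by lia), Nat.sub_add_cancel hn1]
    simpa [hfst, (by lia : n ≠ 0)] using hO n hn
  · rw [Finset.mem_Icc] at hn
    dsimp only
    split_ifs with h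
    · rw [h, hv1]
    · obtain ⟨m, rfl⟩ : ∃ m, n = m + 1 := ⟨n - 1, by lia⟩
      have hm : m ∈ Finset.Icc 1 l := Finset.mem_Icc.2 (by lia)
      exact (huniq m hm _ (hv m (Finset.mem_Icc.2 (by lia))) _ (hv _ (Finset.mem_Icc.2 hn))
        ((hvO m hm).trans_ne one_ne_zero)).2
end

section
/- Fix finite sets S and A, a positive integer K, and trajectories τ_m = ((s^m_n, a^m_n, r^m_{n+1}, s^m_{n+1}))_{n=1,…,l_m} for m = 1,…,M. Suppose a mapping assignment O(m,n,i,j) ∈ {0,1} satisfies all of constraints (C1)–(C5): (C1) for every m, n, ∑_{i,j} O(m,n,i,j) = 1; (C2) for every m, ∑_j O(m,1,1,j) = 1; (C3) for every m, n < l_m, and j, ∑_i O(m,n,i,j) = ∑_{j'} O(m,n+1,j,j'); (C4) mapped target state indices agree across tuples sharing the same (s,a,s') and source index i; (C5) mapped rewards agree across tuples sharing the same (s,a,s') and the same index pair (i,j). Then there exists a Reward Machine (U, u_1, δ_u, δ_r) with U = {1,…,K}, initial state u_1 = 1, δ_u : U × (S × A × S) → U and δ_r : U × (S × A × S) × U →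 ℝ, that reproduces every trajectory: for every m, the run u^m(1) = 1, u^m(n+1) = δ_u(u^m(n), (s^m_n, a^m_n, s^m_{n+1})) satisfies δ_r(u^m(n), (s^m_n, a^m_n, s^m_{n+1}), u^m(n+1)) = r^m_{n+1} for every n ∈ {1,…,l_m}. -/
/-- A nonzero sum of terms in `{0, 1}` has a term equal to `1`. -/
theorem Finset.exists_eq_one_of_sum_ne_zero_of_binary {ι R : Type*} [AddCommMonoid R] [One R]
    {t : Finset ι} {f : ι → R} (hf : ∀ i ∈ t, f i = 0 ∨ f i = 1) (h : ∑ i ∈ t, f i ≠ 0) :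
    ∃ i ∈ t, f i = 1 :=
  let ⟨i, hi, hne⟩ := Finset.exists_ne_zero_of_sum_ne_zero h
  ⟨i, hi, (hf i hi).resolve_left hne⟩

/-- Correctness of the paper's Reward-Machine extraction (Section 4.3): if a binary
mapping assignment `O` satisfies constraints (C1)–(C5), then there is a Reward Machine
with state set `U = {1,…,K}`, initial state `1`, transition function `δ_u` and reward
function `δ_r` over the label set `S × A × S`, whose run `u^m(1) = 1`,
`u^m(n+1) = δ_u(u^m(n), (s^m_n, a^m_n, s^m_{n+1}))` reproduces the rewards of every
observed trajectory. -/
theorem extraction_correct (S A : Type) [Fintype S] [Fintype A]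
    (K M : ℕ) (hK : 0 < K)
    (l : ℕ → ℕ) (s : ℕ → ℕ → S) (a : ℕ → ℕ → A) (rew : ℕ → ℕ → ℝ)
    (O : ℕ → ℕ → ℕ → ℕ → ℝ)
    (hbin : ∀ m ∈ Finset.Icc 1 M, ∀ n ∈ Finset.Icc 1 (l m),
      ∀ i ∈ Finset.Icc 1 K, ∀ j ∈ Finset.Icc 1 K, O m n i j = 0 ∨ O m n i j = 1)
    (hC1 : ∀ m ∈ Finset.Icc 1 M, ∀ n ∈ Finset.Icc 1 (l m),
      ∑ i ∈ Finset.Icc 1 K, ∑ j ∈ Finset.Icc 1 K, O m n i j = 1)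
    (hC2 : ∀ m ∈ Finset.Icc 1 M, ∑ j ∈ Finset.Icc 1 K, O m 1 1 j = 1)
    (hC3 : ∀ m ∈ Finset.Icc 1 M, ∀ n ∈ Finset.Icc 1 (l m - 1), ∀ j ∈ Finset.Icc 1 K,
      ∑ i ∈ Finset.Icc 1 K, O m n i j = ∑ j' ∈ Finset.Icc 1 K, O m (n + 1) j j')
    (hC4 : ∀ m ∈ Finset.Icc 1 M, ∀ n ∈ Finset.Icc 1 (l m),
      ∀ m' ∈ Finset.Icc 1 M, ∀ n' ∈ Finset.Icc 1 (l m'),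
      ∀ i ∈ Finset.Icc 1 K, ∀ j ∈ Finset.Icc 1 K, ∀ j' ∈ Finset.Icc 1 K,
        (s m n, a m n, s m (n + 1)) = (s m' n', a m' n', s m' (n' + 1)) →
        O m n i j = 1 → O m' n' i j' = 1 → j = j')
    (hC5 : ∀ m ∈ Finset.Icc 1 M, ∀ n ∈ Finset.Icc 1 (l m),
      ∀ m' ∈ Finset.Icc 1 M, ∀ n' ∈ Finset.Icc 1 (l m'),
      ∀ i ∈ Finset.Icc 1 K, ∀ j ∈ Finset.Icc 1 K,
        (s m n, a m n, s m (n + 1)) = (s m' n', a m' n', s m' (n' + 1)) →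
        O m n i j = 1 → O m' n' i j = 1 → rew m n = rew m' n') :
    ∃ δu : ℕ → S × A × S → ℕ, ∃ δr : ℕ → S × A × S → ℕ → ℝ,
      (∀ i ∈ Finset.Icc 1 K, ∀ x : S × A × S, δu i x ∈ Finset.Icc 1 K) ∧
      ∀ m ∈ Finset.Icc 1 M, ∀ u : ℕ → ℕ, u 1 = 1 →
        (∀ n ∈ Finset.Icc 1 (l m),
          u (n + 1) = δu (u n) (s m n, a m n, s m (n + 1))) →
        ∀ n ∈ Finset.Icc 1 (l m),
          δr (u n) (s m n, a m n, s m (n + 1)) (u (n + 1)) = rew m n := by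
  have transition : ∀ (i : ℕ) (x : S × A × S), ∃ k ∈ Finset.Icc 1 K,
      ∀ m ∈ Finset.Icc 1 M, ∀ n ∈ Finset.Icc 1 (l m), ∀ j ∈ Finset.Icc 1 K,
        i ∈ Finset.Icc 1 K → (s m n, a m n, s m (n + 1)) = x → O m n i j = 1 → k = j := by
    intro i x
    by_cases h : ∃ m ∈ Finset.Icc 1 M, ∃ n ∈ Finset.Icc 1 (l m), ∃ j ∈ Finset.Icc 1 K,
        (s m n, a m n, s m (n + 1)) = x ∧ O m n i j = 1
    · obtain ⟨m, hm, n, hn, j, hj, hx, hO⟩ := h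
      exact ⟨j, hj, fun m' hm' n' hn' j' hj' hi hx' hO' =>
        hC4 m hm n hn m' hm' n' hn' i hi j hj j' hj' (hx.trans hx'.symm) hO hO'⟩
    · exact ⟨1, Finset.mem_Icc.2 ⟨le_rfl, hK⟩, fun m hm n hn j hj _ hx hO =>
        absurd ⟨m, hm, n, hn, j, hj, hx, hO⟩ h⟩
  have reward : ∀ (i : ℕ) (x : S × A × S) (j : ℕ), ∃ r : ℝ,
      ∀ m ∈ Finset.Icc 1 M, ∀ n ∈ Finset.Icc 1 (l m), i ∈ Finset.Icc 1 K → j ∈ Finset.Icc 1 K →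
        (s m n, a m n, s m (n + 1)) = x → O m n i j = 1 → r = rew m n := by
    intro i x j
    by_cases h : ∃ m ∈ Finset.Icc 1 M, ∃ n ∈ Finset.Icc 1 (l m),
        (s m n, a m n, s m (n + 1)) = x ∧ O m n i j = 1
    · obtain ⟨m, hm, n, hn, hx, hO⟩ := h
      exact ⟨rew m n, fun m' hm' n' hn' hi hj hx' hO' =>
        hC5 m hm n hn m' hm' n' hn' i hi j hj (hx.trans hx'.symm) hO hO'⟩
    · exact ⟨0, fun m hm n hn _ _ hx hO => absurd ⟨m, hm, n, hn, hx, hO⟩ h⟩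
  choose δu hδu_mem hδu using transition
  choose δr hδr using reward
  refine ⟨δu, δr, fun i _ x => hδu_mem i x, fun m hm u hu1 hu => ?_⟩
  have run_mapped : ∀ n, 1 ≤ n → n ≤ l m →
      u n ∈ Finset.Icc 1 K ∧ ∃ j ∈ Finset.Icc 1 K, O m n (u n) j = 1 := by
    intro n hn
    induction n, hn using Nat.le_induction with
    | base =>
      intro hl
      have h1 : 1 ∈ Finset.Icc 1 K := Finset.mem_Icc.2 ⟨le_rfl, hK⟩
      rw [hu1]
      exact ⟨h1, Finset.exists_eq_one_of_sum_ne_zero_of_binary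
        (hbin m hm 1 (Finset.mem_Icc.2 ⟨le_rfl, hl⟩) 1 h1) (by simp [hC2 m hm])⟩
    | succ n hn ih =>
      intro hl
      obtain ⟨hi, j, hj, hO⟩ := ih (by omega)
      have hn' : n ∈ Finset.Icc 1 (l m) := Finset.mem_Icc.2 ⟨hn, by omega⟩
      have huj : u (n + 1) = j := (hu n hn').trans (hδu _ _ m hm n hn' j hj hi rfl hO)
      rw [huj]
      refine ⟨hj, Finset.exists_eq_one_of_sum_ne_zero_of_binary
        (hbin m hm (n + 1) (Finset.mem_Icc.2 ⟨by omega, hl⟩) j hj) ?_⟩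
      rw [← hC3 m hm n (Finset.mem_Icc.2 ⟨hn, by omega⟩) j hj]
      refine (Finset.sum_pos' (fun i hi => ?_) ⟨u n, hi, by simp [hO]⟩).ne'
      rcases hbin m hm n hn' i hi j hj with h | h <;> simp [h]
  intro n hn
  obtain ⟨hi, j, hj, hO⟩ := run_mapped n (Finset.mem_Icc.1 hn).1 (Finset.mem_Icc.1 hn).2
  rw [(hu n hn).trans (hδu _ _ m hm n hn j hj hi rfl hO)]
  exact hδr _ _ _ m hm n hn hi hj rfl hO
end

section
/- Fix finite sets S and A and a finite family of finite trajectories τ_m = ((s^m_n, a^m_n, r^m_{n+1}, s^m_{n+1}))_{n=1,…,l_m} that is reward-consistent: whenever two trajectories have identical state-action prefixes up to step n (i.e., (s^m_k, a^m_k, s^m_{k+1}) = (s^{m̃}_k, a^{m̃}_k, s^{m̃}_{k+1}) for all k ≤ n), their rewards agree on that prefix (r^m_{k+1} = r^{m̃}_{k+1} for all k ≤ n). Then there exists a finite Reward Machine (U, u_1, δ_u, δ_r) over the label set S × A × S that reproduces the rewards of every trajectory in the family; in particular, the paper's constraint system is feasible for some finite K, so the deepening strategy terminates. -/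
/-- The word formed by the entries `x 1, …, x n` of a sequence. -/
def prefixWord {α : Type*} (x : ℕ → α) (n : ℕ) : List α :=
  (List.range n).map fun i => x (i + 1)

theorem prefixWord_succ {α : Type*} (x : ℕ → α) (n : ℕ) :
    prefixWord x (n + 1) = prefixWord x n ++ [x (n + 1)] := by
  simp [prefixWord, List.range_succ]

@[simp]
theorem length_prefixWord {α : Type*} (x : ℕ → α) (n : ℕ) :
    (prefixWord x n).length = n := by
  simp [prefixWord]

theorem eq_of_prefixWord_eq {α : Type*} {x y : ℕ → α} {n : ℕ}
    (h : prefixWord x n = prefixWord y n) : ∀ k ∈ Finset.Icc 1 n, x k = y k := by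
  intro k hk
  obtain ⟨hk1, hkn⟩ := Finset.mem_Icc.mp hk
  have := List.map_inj_left.mp h (k - 1) (List.mem_range.mpr (by omega))
  simpa [Nat.sub_add_cancel hk1] using this

/-- A function determined on `P` by a key factors through the key. -/
theorem exists_factor_on {ι κ β : Type*} [Nonempty β] (P : ι → Prop) (key : ι → κ) (v : ι → β)
    (h : ∀ i j, P i → P j → key i = key j → v i = v j) :
    ∃ f : κ → β, ∀ i, P i → f (key i) = v i := by
  have hf : (fun i : Subtype P => v i).FactorsThrough (fun i : Subtype P => key i) :=
    fun i j hij => h i j i.2 j.2 hij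
  obtain ⟨b⟩ := ‹Nonempty β›
  exact ⟨Function.extend (fun i : Subtype P => key i) (fun i => v i) fun _ => b,
    fun i hi => hf.extend_apply _ ⟨i, hi⟩⟩

/-- Append a letter to a word of length at most `N`, leaving words of length `N` unchanged. -/
def boundedSnoc {α : Type*} {N : ℕ} (w : {w : List α // w.length ≤ N}) (x : α) :
    {w : List α // w.length ≤ N} :=
  if h : w.1.length < N then ⟨w.1 ++ [x], by simpa using h⟩ else w

theorem run_boundedSnoc_eq_prefixWord {α : Type*} {N l : ℕ} (hl : l ≤ N) (x : ℕ → α)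
    (u : ℕ → {w : List α // w.length ≤ N}) (h1 : (u 1).1 = [])
    (hu : ∀ n ∈ Finset.Icc 1 l, u (n + 1) = boundedSnoc (u n) (x n)) :
    ∀ n ≤ l, (u (n + 1)).1 = prefixWord x n := by
  intro n
  induction n with
  | zero => exact fun _ => by simpa [prefixWord] using h1
  | succ n ih =>
    intro hn
    have hw := ih (by omega)
    have hlt : (u (n + 1)).1.length < N := by rw [hw, length_prefixWord]; omega
    rw [hu (n + 1) (Finset.mem_Icc.mpr ⟨by omega, hn⟩), boundedSnoc, dif_pos hlt,
      prefixWord_succ, ← hw]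


/-- If the finite family of finite trajectories is reward-consistent — identical
state-action prefixes carry identical rewards — then there exists a finite Reward
Machine `(U, u_1, δ_u, δ_r)` over the label set `S × A × S` (e.g. the prefix tree of
the observations) whose run reproduces the rewards of every trajectory; in particular
the paper's constraint system is feasible for some finite `K`. -/
theorem consistent_implies_rm (S A : Type) [Fintype S] [Fintype A]
    (M : ℕ) (l : ℕ → ℕ) (s : ℕ → ℕ → S) (a : ℕ → ℕ → A) (rew : ℕ → ℕ → ℝ)
    (hcons : ∀ m ∈ Finset.Icc 1 M, ∀ m' ∈ Finset.Icc 1 M,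
      ∀ n, n ≤ l m → n ≤ l m' →
        (∀ k ∈ Finset.Icc 1 n,
          (s m k, a m k, s m (k + 1)) = (s m' k, a m' k, s m' (k + 1))) →
        ∀ k ∈ Finset.Icc 1 n, rew m k = rew m' k) :
    ∃ (U : Type), Finite U ∧
      ∃ (u1 : U) (δu : U → S × A × S → U) (δr : U → S × A × S → U → ℝ),
        ∀ m ∈ Finset.Icc 1 M, ∀ u : ℕ → U, u 1 = u1 →
          (∀ n ∈ Finset.Icc 1 (l m),
            u (n + 1) = δu (u n) (s m n, a m n, s m (n + 1))) →
          ∀ n ∈ Finset.Icc 1 (l m),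
            δr (u n) (s m n, a m n, s m (n + 1)) (u (n + 1)) = rew m n := by
  let x : ℕ → ℕ → S × A × S := fun m n => (s m n, a m n, s m (n + 1))
  let N := (Finset.Icc 1 M).sup l
  obtain ⟨f, hf⟩ := exists_factor_on
    (fun p : ℕ × ℕ => p.1 ∈ Finset.Icc 1 M ∧ p.2 ∈ Finset.Icc 1 (l p.1))
    (fun p => prefixWord (x p.1) p.2) (fun p => rew p.1 p.2) (by
      rintro ⟨m, n⟩ ⟨m', n'⟩ ⟨hm, hn⟩ ⟨hm', hn'⟩ h
      have hlen : n = n' := by simpa using congrArg List.length h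
      subst hlen
      rw [Finset.mem_Icc] at hn hn'
      exact hcons m hm m' hm' n hn.2 hn'.2 (eq_of_prefixWord_eq h) n
        (Finset.mem_Icc.mpr ⟨hn.1, le_rfl⟩))
  refine ⟨{w : List (S × A × S) // w.length ≤ N}, (List.finite_length_le _ N).to_subtype,
    ⟨[], Nat.zero_le _⟩, boundedSnoc, fun _ _ w => f w.1, ?_⟩
  intro m hm u h1 hu n hn
  have hw := run_boundedSnoc_eq_prefixWord (Finset.le_sup hm) (x m) u (by rw [h1]) hu n
    (Finset.mem_Icc.mp hn).2
  simpa only [hw] using hf (m, n) ⟨hm, hn⟩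
end

section
/- Let (U, u_1, δ_u, δ_r) be a Reward Machine over label set Λ with U finite, and let N be a positive integer. Then there exists a Reward Machine (U', u'_1, δ'_u, δ'_r) with U' a finite linearly ordered state set such that δ'_u never decreases (δ'_u(u, p) ≥ u for all u ∈ U' and p ∈ Λ, i.e., the machine never returns to a previously left state) and such that for every label sequence p_1, …, p_l with l ≤ N, the reward sequence emitted by (U', u'_1, δ'_u, δ'_r) equals the reward sequence emitted by (U, u_1, δ_u, δ_r); moreover |U'| ≤ (N+1)·|U|. -/
/-- The layered unrolling of a transition function: a state is a layer in `Fin (N + 1)` together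
with an original state, and every transition before the last layer moves to the next layer. -/
def unrolledStep {Λ : Type*} {N k : ℕ} (δ : Fin k → Λ → Fin k) (s : Fin ((N + 1) * k)) (p : Λ) :
    Fin ((N + 1) * k) :=
  if h : (finProdFinEquiv.symm s).1.val + 1 < N + 1 then
    finProdFinEquiv (⟨_, h⟩, δ (finProdFinEquiv.symm s).2 p)
  else s

theorem unrolledStep_finProdFinEquiv {Λ : Type*} {N k m : ℕ} (δ : Fin k → Λ → Fin k)
    (hm : m + 1 < N + 1) (i : Fin k) (p : Λ) :
    unrolledStep δ (finProdFinEquiv (⟨m, (Nat.lt_succ_self m).trans hm⟩, i)) p =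
      finProdFinEquiv (⟨m + 1, hm⟩, δ i p) := by
  simp only [unrolledStep, Equiv.symm_apply_apply]
  exact dif_pos hm

theorem le_unrolledStep {Λ : Type*} {N k : ℕ} (δ : Fin k → Λ → Fin k) (s : Fin ((N + 1) * k))
    (p : Λ) : s ≤ unrolledStep δ s p := by
  obtain ⟨⟨t, i⟩, rfl⟩ := finProdFinEquiv.surjective s
  by_cases h : t.val + 1 < N + 1
  · rw [unrolledStep_finProdFinEquiv δ h, Fin.le_def, finProdFinEquiv_apply_val,
      finProdFinEquiv_apply_val]
    have := i.isLt
    simp only [mul_add, mul_one]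
    omega
  · simp only [unrolledStep, Equiv.symm_apply_apply]
    rw [dif_neg h]

/-- Cycle unrolling (Appendix B): any Reward Machine `(U, u1, δu, δr)` with finite `U`
can be replaced, for label sequences of length at most `N`, by an equivalent Reward
Machine on a finite linearly ordered state set (`Fin K'`) whose transition function
never decreases — i.e. it never returns to a previously left state — emitting the same
reward sequences, with `|U'| = K' ≤ (N+1)·|U|`. -/
theorem unroll_rm (Λ : Type) (U : Type) [Fintype U]
    (u1 : U) (δu : U → Λ → U) (δr : U → Λ → U → ℝ) (N : ℕ) (hN : 0 < N) :
    ∃ (K' : ℕ) (u1' : Fin K') (δu' : Fin K' → Λ → Fin K')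
      (δr' : Fin K' → Λ → Fin K' → ℝ),
      (∀ (u : Fin K') (p : Λ), u ≤ δu' u p) ∧
      (∀ l : ℕ, l ≤ N → ∀ p : ℕ → Λ,
        ∀ u : ℕ → U, u 1 = u1 →
          (∀ n ∈ Finset.Icc 1 l, u (n + 1) = δu (u n) (p n)) →
        ∀ u' : ℕ → Fin K', u' 1 = u1' →
          (∀ n ∈ Finset.Icc 1 l, u' (n + 1) = δu' (u' n) (p n)) →
        ∀ n ∈ Finset.Icc 1 l,
          δr' (u' n) (p n) (u' (n + 1)) = δr (u n) (p n) (u (n + 1))) ∧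
      K' ≤ (N + 1) * Fintype.card U := by
  let e := Fintype.equivFin U
  let δ : Fin (Fintype.card U) → Λ → Fin (Fintype.card U) := fun i p => e (δu (e.symm i) p)
  refine ⟨(N + 1) * Fintype.card U, finProdFinEquiv (0, e u1), unrolledStep δ,
    fun s p _ => δr (e.symm (finProdFinEquiv.symm s).2) p
      (δu (e.symm (finProdFinEquiv.symm s).2) p),
    le_unrolledStep δ, ?_, le_rfl⟩
  intro l hl p u hu1 hu u' hu1' hu' n hn
  have run : ∀ m (hm : m ≤ l),
      u' (m + 1) = finProdFinEquiv (⟨m, by omega⟩, e (u (m + 1))) := by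
    intro m
    induction m with
    | zero =>
      intro _
      rw [hu1', hu1]
      rfl
    | succ m ih =>
      intro hm
      have hmem : m + 1 ∈ Finset.Icc 1 l := Finset.mem_Icc.2 ⟨by omega, hm⟩
      rw [hu' _ hmem, hu _ hmem, ih (by omega), unrolledStep_finProdFinEquiv δ (by omega)]
      simp [δ]
  obtain ⟨h1, hnl⟩ := Finset.mem_Icc.1 hn
  obtain ⟨m, rfl⟩ := Nat.exists_eq_add_of_le' h1
  rw [run m (by omega), hu _ hn]
  simp
end
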